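/- Let m be a positive integer, α = (α₁, …, α_m) an m-tuple of real numbers, and n ≥ 2 an integer. For a positive integer q define ℓ(q) = √(Σ_{i=1}^m ‖qαᵢ‖²), and say q has type s ∈ {+,−}^m where the i-th sign is + if {qαᵢ} ≥ 1/2 and − otherwise. Let Q₁ be the least integer in {1, …, ⌊n/2⌋} with ℓ(Q₁) ≤ ℓ(q) for all integers 1 ≤ q ≤ n/2. Let Q₁^⊥ = { q : 1 ≤ q ≤ n − Q₁, q does not have the same type as Q₁ }, assume Q₁^⊥ is nonempty, and let Q₂ be the least integer in Q₁^⊥ with ℓ(Q₂) ≤ ℓ(q) for all q ∈ Q₁^⊥. Then the number of integers q with 1 ≤ q < Q₁ and ℓ(q) < ℓ(Q₂) is at most ⌈√(2m)⌉^m. -/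

import Mathlib

open scoped Classical

/-- `nint x` is the distance from the real number `x` to the nearest integer. -/
noncomputable def nint (x : ℝ) : ℝ := |x - round x|

/-- `lenm α q = √(Σᵢ ‖qαᵢ‖²)`, the length of the integer `q` w.r.t. `α : Fin m → ℝ`. -/
noncomputable def lenm {m : ℕ} (α : Fin m → ℝ) (q : ℕ) : ℝ :=
  Real.sqrt (∑ i, nint ((q : ℝ) * α i) ^ 2)

/-- The type of the integer `q` w.r.t. `α : Fin m → ℝ`: the `m`-tuple of signs of
`{qαᵢ} − 1/2` (`true` = `+`, `false` = `−`). -/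
noncomputable def typm {m : ℕ} (α : Fin m → ℝ) (q : ℕ) : Fin m → Bool :=
  fun i => if 1 / 2 ≤ Int.fract ((q : ℝ) * α i) then true else false

theorem nint_eq_min (x : ℝ) : nint x = min (Int.fract x) (1 - Int.fract x) :=
  abs_sub_round_eq_min x

theorem nint_nonneg (x : ℝ) : 0 ≤ nint x := abs_nonneg _

theorem fract_sub_eq_or (x y : ℝ) :
    Int.fract (x - y) = Int.fract x - Int.fract y ∨
      Int.fract (x - y) = Int.fract x - Int.fract y + 1 := by
  have hx := Int.fract_nonneg x
  have hx' := Int.fract_lt_one x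
  have hy := Int.fract_nonneg y
  have hy' := Int.fract_lt_one y
  rcases le_or_gt (Int.fract y) (Int.fract x) with h | h
  · left
    rw [Int.fract_eq_iff]
    refine ⟨by linarith, by linarith, ⌊x⌋ - ⌊y⌋, ?_⟩
    push_cast
    simp only [Int.fract]
    ring
  · right
    rw [Int.fract_eq_iff]
    refine ⟨by linarith, by linarith, ⌊x⌋ - ⌊y⌋ - 1, ?_⟩
    push_cast
    simp only [Int.fract]
    ring

/-- On the same side of `1/2`, the distance to the nearest integer of a difference is the
difference of the distances. -/
theorem nint_sub_eq (x y : ℝ) (h : 1 / 2 ≤ Int.fract x ↔ 1 / 2 ≤ Int.fract y) :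
    nint (x - y) = |nint x - nint y| := by
  have hx := Int.fract_nonneg x
  have hx' := Int.fract_lt_one x
  have hy := Int.fract_nonneg y
  have hy' := Int.fract_lt_one y
  have hz := Int.fract_nonneg (x - y)
  have hz' := Int.fract_lt_one (x - y)
  simp only [nint_eq_min]
  by_cases hc : 1 / 2 ≤ Int.fract x <;> have hd := hc <;> rw [h] at hd <;>
    rcases fract_sub_eq_or x y with e | e <;> rw [e] at hz hz' ⊢ <;> grind

theorem nint_le_of_sub (x y : ℝ) (h : 1 / 2 ≤ Int.fract x ↔ 1 / 2 ≤ Int.fract y)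
    (h' : 1 / 2 ≤ Int.fract (x - y) ↔ 1 / 2 ≤ Int.fract y) : nint y ≤ nint x := by
  have hx := Int.fract_nonneg x
  have hx' := Int.fract_lt_one x
  have hy := Int.fract_nonneg y
  have hy' := Int.fract_lt_one y
  have hz := Int.fract_nonneg (x - y)
  have hz' := Int.fract_lt_one (x - y)
  simp only [nint_eq_min]
  by_cases hc : 1 / 2 ≤ Int.fract y <;> have hd := hc <;> rw [← h] at hd <;>
    have he := hc <;> rw [← h'] at he <;>
    rcases fract_sub_eq_or x y with e | e <;> rw [e] at hz hz' he <;> grind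

theorem typm_eq_iff {m : ℕ} {α : Fin m → ℝ} {p q : ℕ} :
    typm α p = typm α q ↔
      ∀ i, (1 / 2 ≤ Int.fract ((p : ℝ) * α i) ↔ 1 / 2 ≤ Int.fract ((q : ℝ) * α i)) := by
  rw [funext_iff]
  refine forall_congr' fun i => ?_
  simp only [typm]
  split_ifs <;> grind

theorem lenm_nonneg {m : ℕ} (α : Fin m → ℝ) (q : ℕ) : 0 ≤ lenm α q := Real.sqrt_nonneg _

theorem lenm_sq {m : ℕ} (α : Fin m → ℝ) (q : ℕ) :
    lenm α q ^ 2 = ∑ i, nint ((q : ℝ) * α i) ^ 2 :=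
  Real.sq_sqrt (Finset.sum_nonneg fun _ _ => sq_nonneg _)

theorem nint_le_lenm {m : ℕ} (α : Fin m → ℝ) (q : ℕ) (i : Fin m) :
    nint ((q : ℝ) * α i) ≤ lenm α q := by
  refine Real.le_sqrt_of_sq_le ?_
  exact Finset.single_le_sum (f := fun j => nint ((q : ℝ) * α j) ^ 2)
    (fun _ _ => sq_nonneg _) (Finset.mem_univ i)

theorem lenm_sub_sq {m : ℕ} {α : Fin m → ℝ} {p q : ℕ} (hqp : q ≤ p)
    (h : typm α p = typm α q) :
    lenm α (p - q) ^ 2 = ∑ i, (nint ((p : ℝ) * α i) - nint ((q : ℝ) * α i)) ^ 2 := by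
  rw [lenm_sq]
  refine Finset.sum_congr rfl fun i _ => ?_
  rw [Nat.cast_sub hqp, sub_mul, nint_sub_eq _ _ (typm_eq_iff.1 h i), sq_abs]

theorem lenm_sub_sq_le {m : ℕ} {α : Fin m → ℝ} {p q : ℕ} (hqp : q ≤ p)
    (h : typm α p = typm α q) :
    lenm α (p - q) ^ 2 ≤ lenm α p ^ 2 + lenm α q ^ 2 := by
  rw [lenm_sub_sq hqp h, lenm_sq, lenm_sq, ← Finset.sum_add_distrib]
  refine Finset.sum_le_sum fun i _ => ?_
  nlinarith [mul_nonneg (nint_nonneg ((p : ℝ) * α i)) (nint_nonneg ((q : ℝ) * α i))]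

theorem lenm_le_of_typm_sub {m : ℕ} {α : Fin m → ℝ} {p q : ℕ} (hqp : q ≤ p)
    (h : typm α p = typm α q) (h' : typm α (p - q) = typm α q) :
    lenm α q ≤ lenm α p := by
  refine Real.sqrt_le_sqrt (Finset.sum_le_sum fun i _ => ?_)
  refine pow_le_pow_left₀ (nint_nonneg _) (nint_le_of_sub _ _ (typm_eq_iff.1 h i) ?_) 2
  have := typm_eq_iff.1 h' i
  rwa [Nat.cast_sub hqp, sub_mul] at this

/-- Lower bound on the length of the integers below `Q₁` having the type of `Q₁`. -/
theorem sq_lt_two_mul_lenm_sq {m : ℕ} {α : Fin m → ℝ} {Q₁ d : ℕ} {L : ℝ} (hL : 0 ≤ L)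
    (hmin : ∀ e, 1 ≤ e → e < Q₁ → lenm α Q₁ < lenm α e)
    (hperp : ∀ e, 1 ≤ e → e < Q₁ → typm α e ≠ typm α Q₁ → L ≤ lenm α e)
    (hd : 1 ≤ d) (hdQ : d < Q₁) (ht : typm α d = typm α Q₁) :
    L ^ 2 < 2 * lenm α d ^ 2 := by
  have hlt := hmin d hd hdQ
  by_cases he : typm α (Q₁ - d) = typm α Q₁
  · exact absurd (lenm_le_of_typm_sub hdQ.le ht.symm (he.trans ht.symm)) (not_le.2 hlt)
  · have h1 := hperp _ (by omega) (by omega) he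
    have h2 := lenm_sub_sq_le hdQ.le ht.symm
    have h3 := pow_le_pow_left₀ hL h1 2
    have h4 := pow_lt_pow_left₀ hlt (lenm_nonneg α Q₁) two_ne_zero
    linarith

/-- Two points of a cell of side `L / K`, where `2 m ≤ K²`, are at distance at most `L / √2`. -/
theorem two_mul_sum_sq_le {m : ℕ} {K L : ℝ} (hK : 0 < K) (hL : 0 < L) (hmK : 2 * m ≤ K ^ 2)
    (a b : Fin m → ℝ) (ha : ∀ i, 0 ≤ a i) (hb : ∀ i, 0 ≤ b i)
    (h : ∀ i, ⌊a i * K / L⌋₊ = ⌊b i * K / L⌋₊) :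
    2 * ∑ i, (a i - b i) ^ 2 ≤ L ^ 2 := by
  have key : ∀ i, (a i - b i) ^ 2 ≤ L ^ 2 / K ^ 2 := fun i => by
    have ha0 : 0 ≤ a i * K / L := div_nonneg (mul_nonneg (ha i) hK.le) hL.le
    have hb0 : 0 ≤ b i * K / L := div_nonneg (mul_nonneg (hb i) hK.le) hL.le
    have h1 := Nat.floor_le ha0
    have h2 := Nat.lt_floor_add_one (a i * K / L)
    have h3 := Nat.floor_le hb0
    have h4 := Nat.lt_floor_add_one (b i * K / L)
    rw [h i] at h1 h2
    have h5 : (a i * K / L - b i * K / L) ^ 2 ≤ 1 := by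
      rw [sq_le_one_iff_abs_le_one, abs_le]
      constructor <;> linarith
    have h6 : a i * K / L - b i * K / L = (a i - b i) * K / L := by ring
    rw [h6, div_pow, mul_pow, div_le_one (by positivity)] at h5
    rwa [le_div_iff₀ (by positivity)]
  have hsum : ∑ i, (a i - b i) ^ 2 ≤ m * (L ^ 2 / K ^ 2) := by
    refine (Finset.sum_le_sum fun i _ => key i).trans ?_
    simp
  have : 2 * (m * (L ^ 2 / K ^ 2)) ≤ L ^ 2 := by
    rw [← mul_assoc, ← mul_div_assoc, div_le_iff₀ (by positivity), mul_comm (L ^ 2)]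
    exact mul_le_mul_of_nonneg_right hmK (sq_nonneg L)
  linarith

/-- Lemma 4 of the paper: with `Q₁` the least minimiser of `ℓ` on `{1, …, ⌊n/2⌋}` and `Q₂`
the least minimiser of `ℓ` on `Q₁^⊥ = {1 ≤ q ≤ n − Q₁ : q` not of the same type as `Q₁}`,
the number of integers `q` with `1 ≤ q < Q₁` and `ℓ(q) < ℓ(Q₂)` is at most `⌈√(2m)⌉^m`. -/
theorem short_below_Q₁_count (m : ℕ) (hm : 1 ≤ m) (α : Fin m → ℝ)
    (n : ℕ) (hn : 2 ≤ n) (Q₁ Q₂ : ℕ)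
    (hQ₁ : IsLeast {q : ℕ | (1 ≤ q ∧ 2 * q ≤ n) ∧
      ∀ q' : ℕ, 1 ≤ q' → 2 * q' ≤ n → lenm α q ≤ lenm α q'} Q₁)
    (hperp : {q : ℕ | 1 ≤ q ∧ q ≤ n - Q₁ ∧ typm α q ≠ typm α Q₁}.Nonempty)
    (hQ₂ : IsLeast {q : ℕ | (1 ≤ q ∧ q ≤ n - Q₁ ∧ typm α q ≠ typm α Q₁) ∧
      ∀ q' : ℕ, 1 ≤ q' → q' ≤ n - Q₁ → typm α q' ≠ typm α Q₁ →
        lenm α q ≤ lenm α q'} Q₂) :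
    Set.ncard {q : ℕ | 1 ≤ q ∧ q < Q₁ ∧ lenm α q < lenm α Q₂}
      ≤ ⌈Real.sqrt (2 * m)⌉₊ ^ m := by
  obtain ⟨⟨⟨hQ1, hQn⟩, hQmin⟩, hleast⟩ := hQ₁
  obtain ⟨⟨-, hQ2min⟩, -⟩ := hQ₂
  have hmin : ∀ e, 1 ≤ e → e < Q₁ → lenm α Q₁ < lenm α e := fun e he heQ => by
    by_contra! hle
    exact absurd (hleast ⟨⟨he, by omega⟩, fun q' h1 h2 => hle.trans (hQmin q' h1 h2)⟩)
      (not_le.2 heQ)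
  set L := lenm α Q₂ with hLdef
  have hfar : ∀ e, 1 ≤ e → e < Q₁ → typm α e ≠ typm α Q₁ → L ≤ lenm α e :=
    fun e he heQ hne => hQ2min e he (by omega) hne
  set K := ⌈Real.sqrt (2 * m)⌉₊ with hKdef
  have hm' : (1 : ℝ) ≤ m := by exact_mod_cast hm
  have hK : (0 : ℝ) < K := by
    exact_mod_cast Nat.ceil_pos.2 (Real.sqrt_pos.2 (by linarith))
  have hmK : 2 * (m : ℝ) ≤ (K : ℝ) ^ 2 := by
    rw [← Real.sqrt_le_left hK.le]
    exact Nat.le_ceil _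
  have hsame : ∀ q, 1 ≤ q → q < Q₁ → lenm α q < L → typm α q = typm α Q₁ :=
    fun q h1 h2 h3 => by
      by_contra hne
      exact absurd (hfar q h1 h2 hne) (not_le.2 h3)
  let cell : ℕ → Fin m → ℕ := fun q i => ⌊nint ((q : ℝ) * α i) * K / L⌋₊
  have hinj : ∀ p q, 1 ≤ q → q < p → p < Q₁ → lenm α p < L → lenm α q < L →
      cell p ≠ cell q := fun p q hq hqp hpQ hp hqL hcell => by
    have hL : 0 < L := (lenm_nonneg α p).trans_lt hp
    have ht : typm α p = typm α q :=
      (hsame p (by omega) hpQ hp).trans (hsame q hq (by omega) hqL).symm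
    have hclose := two_mul_sum_sq_le hK hL hmK _ _ (fun i => nint_nonneg ((p : ℝ) * α i))
      (fun i => nint_nonneg ((q : ℝ) * α i)) (fun i => congrFun hcell i)
    rw [← lenm_sub_sq hqp.le ht] at hclose
    by_cases hd : typm α (p - q) = typm α Q₁
    · exact absurd (sq_lt_two_mul_lenm_sq hL.le hmin hfar (by omega) (by omega) hd)
        (not_lt.2 hclose)
    · have := pow_le_pow_left₀ hL.le (hfar _ (by omega) (by omega) hd) 2
      nlinarith [sq_pos_of_pos hL]
  have hcard : ((Fintype.piFinset fun _ : Fin m => Finset.range K : Finset (Fin m → ℕ)) :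
      Set (Fin m → ℕ)).ncard = K ^ m := by
    rw [Set.ncard_coe_finset, Fintype.card_piFinset]
    simp
  rw [← hcard]
  refine Set.ncard_le_ncard_of_injOn cell ?_ ?_ (Finset.finite_toSet _)
  · rintro q ⟨-, -, hqL⟩
    have hL : 0 < L := (lenm_nonneg α q).trans_lt hqL
    simp only [Finset.mem_coe, Fintype.mem_piFinset, Finset.mem_range]
    intro i
    rw [Nat.floor_lt (div_nonneg (mul_nonneg (nint_nonneg _) hK.le) hL.le), div_lt_iff₀ hL,
      mul_comm]
    exact mul_lt_mul_of_pos_left ((nint_le_lenm α q i).trans_lt hqL) hK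
  · rintro p ⟨hp1, hpQ, hpL⟩ q ⟨hq1, hqQ, hqL⟩ hpq
    rcases lt_trichotomy p q with h | h | h
    · exact absurd hpq.symm (hinj q p hp1 h hqQ hqL hpL)
    · exact h
    · exact absurd hpq (hinj p q hq1 h hpQ hpL hqL)
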